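/- arXiv:2401.17239 — 3 statements merged into one kernel-verified Lean document; each statement's English description precedes it below -/
import Mathlib

section
/- Let T > 0 and ε ∈ ℝ. Let V, h, ζ, ζ̄, V̄, δr, δV, δb, p, q : ℝ × ℝ → ℝ be smooth (C^∞) functions, with δr, δV, δb, p, q all supported, in the space variable x, in a fixed compact subset of ℝ for every t ∈ [0,T]. Assume that on [0,T] × ℝ the linearized state equations ∂_t δr + ∂_x(εV·δr + h·δV) = 0 and ∂_t δV + ∂_x δr + ε ∂_x(V·δV) = −∂_x δb − (ε/2) ∂_x ∂_t² δb hold, the adjoint equations ∂_t p + εV ∂_x p + ∂_x q = ζ̄ − ζ and ∂_t q + h ∂_x p + εV ∂_x q = V̄ − V hold, and the end conditions δr(0,·) = 0, δV(0,·) = 0, p(T,·) = 0, q(T,·) = 0, δb(0,·) = δb(T,·) = 0, ∂_t δb(0,·) = ∂_t δb(T,·) = 0 hold. Then ∫₀ᵀ ∫_ℝ [(ζ − ζ̄)·(δr + δb) + (V − V̄)·δV] dx dt = ∫₀ᵀ ∫_ℝ δb·( ∂_x q + (ε/2) ∂_t² ∂_x q + (ζ − ζ̄) ) dx dt. -/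
open MeasureTheory intervalIntegral

/-- Partial derivative in the first (time) variable. -/
noncomputable def pt (f : ℝ → ℝ → ℝ) (t x : ℝ) : ℝ := deriv (fun s => f s x) t

/-- Partial derivative in the second (space) variable. -/
noncomputable def px (f : ℝ → ℝ → ℝ) (t x : ℝ) : ℝ := deriv (fun y => f t y) x

namespace ContDiff

variable {f : ℝ → ℝ → ℝ}

theorem hasDerivAt_pt (hf : ContDiff ℝ (⊤ : ℕ∞) (fun z : ℝ × ℝ => f z.1 z.2)) (t x : ℝ) :
    HasDerivAt (fun s => f s x) (pt f t x) t := by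
  have h : ContDiff ℝ (⊤ : ℕ∞) (fun s => f s x) :=
    hf.comp (contDiff_id.prodMk contDiff_const)
  exact (h.differentiable (by simp) t).hasDerivAt

theorem hasDerivAt_px (hf : ContDiff ℝ (⊤ : ℕ∞) (fun z : ℝ × ℝ => f z.1 z.2)) (t x : ℝ) :
    HasDerivAt (fun y => f t y) (px f t x) x := by
  have h : ContDiff ℝ (⊤ : ℕ∞) (fun y => f t y) :=
    hf.comp (contDiff_const.prodMk contDiff_id)
  exact (h.differentiable (by simp) x).hasDerivAt

theorem pt_smooth (hf : ContDiff ℝ (⊤ : ℕ∞) (fun z : ℝ × ℝ => f z.1 z.2)) :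
    ContDiff ℝ (⊤ : ℕ∞) (fun z : ℝ × ℝ => pt f z.1 z.2) := by
  have key : (fun z : ℝ × ℝ => pt f z.1 z.2)
      = fun z => fderiv ℝ (fun z : ℝ × ℝ => f z.1 z.2) z (1, 0) := by
    funext z
    have h := (hf.differentiable (by simp) z).hasFDerivAt
    exact (h.comp_hasDerivAt (f := fun s => (s, z.2)) z.1
      ((hasDerivAt_id _).prodMk (hasDerivAt_const _ _))).deriv
  rw [key]
  exact (hf.fderiv_right (m := (⊤ : ℕ∞)) (by simp)).clm_apply contDiff_const

theorem px_smooth (hf : ContDiff ℝ (⊤ : ℕ∞) (fun z : ℝ × ℝ => f z.1 z.2)) :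
    ContDiff ℝ (⊤ : ℕ∞) (fun z : ℝ × ℝ => px f z.1 z.2) := by
  have key : (fun z : ℝ × ℝ => px f z.1 z.2)
      = fun z => fderiv ℝ (fun z : ℝ × ℝ => f z.1 z.2) z (0, 1) := by
    funext z
    have h := (hf.differentiable (by simp) z).hasFDerivAt
    exact (h.comp_hasDerivAt (f := fun y => (z.1, y)) z.2
      ((hasDerivAt_const _ _).prodMk (hasDerivAt_id _))).deriv
  rw [key]
  exact (hf.fderiv_right (m := (⊤ : ℕ∞)) (by simp)).clm_apply contDiff_const

end ContDiff

/-- The divergence of a smooth field whose normal component vanishes on the boundary of a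
rectangle has zero integral over the rectangle. -/
theorem integral_divergence_eq_zero {a b c d : ℝ} {A B : ℝ → ℝ → ℝ}
    (hA : ContDiff ℝ (⊤ : ℕ∞) (fun z : ℝ × ℝ => A z.1 z.2))
    (hB : ContDiff ℝ (⊤ : ℕ∞) (fun z : ℝ × ℝ => B z.1 z.2))
    (hAa : ∀ x, A a x = 0) (hAb : ∀ x, A b x = 0)
    (hBc : ∀ t ∈ Set.uIcc a b, B t c = 0) (hBd : ∀ t ∈ Set.uIcc a b, B t d = 0) :
    ∫ t in a..b, ∫ x in c..d, (pt A t x + px B t x) = 0 := by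
  have cA : Continuous (fun z : ℝ × ℝ => pt A z.1 z.2) := hA.pt_smooth.continuous
  have cB : Continuous (fun z : ℝ × ℝ => px B z.1 z.2) := hB.px_smooth.continuous
  have inner : ∀ t ∈ Set.uIcc a b,
      ∫ x in c..d, (pt A t x + px B t x) = ∫ x in c..d, pt A t x := by
    intro t ht
    have cAt : Continuous (fun x => pt A t x) := cA.comp (by fun_prop : Continuous fun x => (t, x))
    have cBt : Continuous (fun x => px B t x) := cB.comp (by fun_prop : Continuous fun x => (t, x))
    rw [integral_add (cAt.intervalIntegrable _ _) (cBt.intervalIntegrable _ _),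
      integral_eq_sub_of_hasDerivAt (fun x _ => hB.hasDerivAt_px t x)
        (cBt.intervalIntegrable _ _), hBc t ht, hBd t ht]
    simp
  have integrable : IntegrableOn (Function.uncurry (pt A)) (Set.uIoc a b ×ˢ Set.uIoc c d) :=
    (cA.continuousOn.integrableOn_compact (isCompact_uIcc.prod isCompact_uIcc)).mono_set
      (Set.prod_mono Set.uIoc_subset_uIcc Set.uIoc_subset_uIcc)
  rw [integral_congr inner, intervalIntegral_intervalIntegral_swap integrable]
  have outer : ∀ x, ∫ t in a..b, pt A t x = 0 := by
    intro x
    have cAx : Continuous (fun t => pt A t x) := cA.comp (by fun_prop : Continuous fun t => (t, x))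
    rw [integral_eq_sub_of_hasDerivAt (fun t _ => hA.hasDerivAt_pt t x)
      (cAx.intervalIntegrable _ _), hAa, hAb, sub_zero]
  simp [outer]

/-- Two continuous functions supported in a fixed compact set in space have the same space-time
integral if they differ by a divergence with vanishing boundary values. -/
theorem integral_eq_of_sub_eq_divergence {T : ℝ} (hT : 0 ≤ T) {K : Set ℝ} (hK : IsCompact K)
    {F G A B : ℝ → ℝ → ℝ}
    (hF : Continuous (fun z : ℝ × ℝ => F z.1 z.2)) (hG : Continuous (fun z : ℝ × ℝ => G z.1 z.2))
    (hA : ContDiff ℝ (⊤ : ℕ∞) (fun z : ℝ × ℝ => A z.1 z.2))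
    (hB : ContDiff ℝ (⊤ : ℕ∞) (fun z : ℝ × ℝ => B z.1 z.2))
    (hFK : ∀ t ∈ Set.Icc (0 : ℝ) T, ∀ x ∉ K, F t x = 0)
    (hGK : ∀ t ∈ Set.Icc (0 : ℝ) T, ∀ x ∉ K, G t x = 0)
    (hBK : ∀ t ∈ Set.Icc (0 : ℝ) T, ∀ x ∉ K, B t x = 0)
    (hA0 : ∀ x, A 0 x = 0) (hAT : ∀ x, A T x = 0)
    (hFG : ∀ t ∈ Set.Icc (0 : ℝ) T, ∀ x, F t x - G t x = pt A t x + px B t x) :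
    ∫ t in (0 : ℝ)..T, ∫ x, F t x = ∫ t in (0 : ℝ)..T, ∫ x, G t x := by
  obtain ⟨R, hR⟩ := hK.isBounded.subset_ball 0
  have hKR : K ⊆ Set.Ioo (-R) R := by simpa [Real.ball_eq_Ioo] using hR
  have restrict : ∀ H : ℝ → ℝ → ℝ, (∀ t ∈ Set.Icc (0 : ℝ) T, ∀ x ∉ K, H t x = 0) →
      ∫ t in (0 : ℝ)..T, ∫ x, H t x = ∫ t in (0 : ℝ)..T, ∫ x in (-R)..R, H t x := by
    intro H hH
    refine integral_congr fun t ht => ?_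
    rw [Set.uIcc_of_le hT] at ht
    refine (integral_eq_integral_of_support_subset fun x hx => ?_).symm
    by_contra hxR
    exact hx (hH t ht x fun hxK => hxR (Set.Ioo_subset_Ioc_self (hKR hxK)))
  have slice : ∀ {H : ℝ → ℝ → ℝ}, Continuous (fun z : ℝ × ℝ => H z.1 z.2) →
      ∀ t, IntervalIntegrable (fun x => H t x) volume (-R) R := fun {H} hH t =>
    (hH.comp (by fun_prop : Continuous fun x => (t, x))).intervalIntegrable _ _
  have outer : ∀ {H : ℝ → ℝ → ℝ}, Continuous (fun z : ℝ × ℝ => H z.1 z.2) →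
      IntervalIntegrable (fun t => ∫ x in (-R)..R, H t x) volume 0 T := fun {H} hH =>
    (continuous_parametric_intervalIntegral_of_continuous' (f := H) hH _ _).intervalIntegrable _ _
  rw [restrict F hFK, restrict G hGK, ← sub_eq_zero,
    ← intervalIntegral.integral_sub (outer hF) (outer hG)]
  refine Eq.trans ?_ (integral_divergence_eq_zero (c := -R) (d := R) hA hB hA0 hAT
      (fun t ht => hBK t (by rwa [Set.uIcc_of_le hT] at ht) _ fun h => (hKR h).1.false)
      (fun t ht => hBK t (by rwa [Set.uIcc_of_le hT] at ht) _ fun h => (hKR h).2.false))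
  refine intervalIntegral.integral_congr fun t ht => ?_
  rw [Set.uIcc_of_le hT] at ht
  simp only [← integral_sub (slice hF t) (slice hG t), hFG t ht]

/-- Duality identity underlying the adjoint-method gradient formula
`∇J = q_x + (ε/2) q_{xtt} − (ζ̄ − ζ)` for the shallow-water (μ = 0)
Boussinesq–Peregrine system. -/
theorem adjoint_duality_identity
    (T ε : ℝ) (hT : 0 < T)
    (V h ζ ζbar Vbar δr δV δb p q : ℝ → ℝ → ℝ)
    (hVs : ContDiff ℝ (⊤ : ℕ∞) (fun z : ℝ × ℝ => V z.1 z.2))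
    (hhs : ContDiff ℝ (⊤ : ℕ∞) (fun z : ℝ × ℝ => h z.1 z.2))
    (hζs : ContDiff ℝ (⊤ : ℕ∞) (fun z : ℝ × ℝ => ζ z.1 z.2))
    (hζbars : ContDiff ℝ (⊤ : ℕ∞) (fun z : ℝ × ℝ => ζbar z.1 z.2))
    (hVbars : ContDiff ℝ (⊤ : ℕ∞) (fun z : ℝ × ℝ => Vbar z.1 z.2))
    (hδrs : ContDiff ℝ (⊤ : ℕ∞) (fun z : ℝ × ℝ => δr z.1 z.2))
    (hδVs : ContDiff ℝ (⊤ : ℕ∞) (fun z : ℝ × ℝ => δV z.1 z.2))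
    (hδbs : ContDiff ℝ (⊤ : ℕ∞) (fun z : ℝ × ℝ => δb z.1 z.2))
    (hps : ContDiff ℝ (⊤ : ℕ∞) (fun z : ℝ × ℝ => p z.1 z.2))
    (hqs : ContDiff ℝ (⊤ : ℕ∞) (fun z : ℝ × ℝ => q z.1 z.2))
    -- compact support in space, uniformly on [0,T]
    (K : Set ℝ) (hK : IsCompact K)
    (hδr_supp : ∀ t ∈ Set.Icc (0:ℝ) T, ∀ x ∉ K, δr t x = 0)
    (hδV_supp : ∀ t ∈ Set.Icc (0:ℝ) T, ∀ x ∉ K, δV t x = 0)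
    (hδb_supp : ∀ t ∈ Set.Icc (0:ℝ) T, ∀ x ∉ K, δb t x = 0)
    (hp_supp : ∀ t ∈ Set.Icc (0:ℝ) T, ∀ x ∉ K, p t x = 0)
    (hq_supp : ∀ t ∈ Set.Icc (0:ℝ) T, ∀ x ∉ K, q t x = 0)
    -- linearized state equations
    (hstate1 : ∀ t ∈ Set.Icc (0:ℝ) T, ∀ x : ℝ,
      pt δr t x + px (fun s y => ε * V s y * δr s y + h s y * δV s y) t x = 0)
    (hstate2 : ∀ t ∈ Set.Icc (0:ℝ) T, ∀ x : ℝ,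
      pt δV t x + px δr t x + ε * px (fun s y => V s y * δV s y) t x
        = -(px δb t x) - ε / 2 * px (pt (pt δb)) t x)
    -- adjoint equations
    (hadj1 : ∀ t ∈ Set.Icc (0:ℝ) T, ∀ x : ℝ,
      pt p t x + ε * V t x * px p t x + px q t x = ζbar t x - ζ t x)
    (hadj2 : ∀ t ∈ Set.Icc (0:ℝ) T, ∀ x : ℝ,
      pt q t x + h t x * px p t x + ε * V t x * px q t x = Vbar t x - V t x)
    -- end conditions
    (hδr0 : ∀ x : ℝ, δr 0 x = 0)
    (hδV0 : ∀ x : ℝ, δV 0 x = 0)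
    (hpT : ∀ x : ℝ, p T x = 0)
    (hqT : ∀ x : ℝ, q T x = 0)
    (hδb0 : ∀ x : ℝ, δb 0 x = 0)
    (hδbT : ∀ x : ℝ, δb T x = 0)
    (hδbt0 : ∀ x : ℝ, pt δb 0 x = 0)
    (hδbtT : ∀ x : ℝ, pt δb T x = 0) :
    ∫ t in (0:ℝ)..T, ∫ x : ℝ,
        ((ζ t x - ζbar t x) * (δr t x + δb t x) + (V t x - Vbar t x) * δV t x)
      = ∫ t in (0:ℝ)..T, ∫ x : ℝ,
          δb t x * (px q t x + ε / 2 * pt (pt (px q)) t x + (ζ t x - ζbar t x)) := by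
  have hqx_supp : ∀ t ∈ Set.Icc (0:ℝ) T, ∀ x ∉ K, px q t x = 0 := by
    intro t ht x hx
    have : (fun y => q t y) =ᶠ[nhds x] fun _ => 0 :=
      Filter.eventually_of_mem (hK.isClosed.isOpen_compl.mem_nhds hx) (hq_supp t ht)
    simpa [px] using this.deriv_eq
  have hδbt := hδbs.pt_smooth
  have hδbtt := hδbt.pt_smooth
  have hqx := hqs.px_smooth
  have hqxt := hqx.pt_smooth
  have hqxtt := hqxt.pt_smooth
  have hW : ContDiff ℝ (⊤ : ℕ∞)
      (fun z : ℝ × ℝ => ε * V z.1 z.2 * δr z.1 z.2 + h z.1 z.2 * δV z.1 z.2) := by fun_prop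
  have hU : ContDiff ℝ (⊤ : ℕ∞) (fun z : ℝ × ℝ => V z.1 z.2 * δV z.1 z.2) := by fun_prop
  symm
  refine integral_eq_of_sub_eq_divergence hT.le hK
    (A := fun t x => p t x * δr t x + q t x * δV t x
      + ε / 2 * (δb t x * pt (px q) t x - pt δb t x * px q t x))
    (B := fun t x => p t x * (ε * V t x * δr t x + h t x * δV t x)
      + q t x * (δr t x + ε * (V t x * δV t x) + δb t x + ε / 2 * pt (pt δb) t x))
    ?_ ?_ (by fun_prop) (by fun_prop) ?_ ?_ ?_ ?_ ?_ ?_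
  · have := hδbs.continuous
    have := hqx.continuous
    have := hqxtt.continuous
    have := hζs.continuous
    have := hζbars.continuous
    fun_prop
  · have := hδbs.continuous
    have := hδrs.continuous
    have := hδVs.continuous
    have := hζs.continuous
    have := hζbars.continuous
    have := hVs.continuous
    have := hVbars.continuous
    fun_prop
  · intro t ht x hx
    simp [hδb_supp t ht x hx]
  · intro t ht x hx
    simp [hδb_supp t ht x hx, hδr_supp t ht x hx, hδV_supp t ht x hx]
  · intro t ht x hx
    simp [hp_supp t ht x hx, hq_supp t ht x hx]
  · intro x
    simp [hδr0, hδV0, hδb0, hδbt0]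
  · intro x
    simp [hpT, hqT, hδbT, hδbtT]
  · intro t ht x
    have hAt := (((hps.hasDerivAt_pt t x).mul (hδrs.hasDerivAt_pt t x)).add
      ((hqs.hasDerivAt_pt t x).mul (hδVs.hasDerivAt_pt t x))).add
      ((((hδbs.hasDerivAt_pt t x).mul (hqxt.hasDerivAt_pt t x)).sub
        ((hδbt.hasDerivAt_pt t x).mul (hqx.hasDerivAt_pt t x))).const_mul (ε / 2))
    have hBx := ((hps.hasDerivAt_px t x).mul
      (hW.hasDerivAt_px (f := fun s y => ε * V s y * δr s y + h s y * δV s y) t x)).add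
      ((hqs.hasDerivAt_px t x).mul ((((hδrs.hasDerivAt_px t x).add
        ((hU.hasDerivAt_px (f := fun s y => V s y * δV s y) t x).const_mul ε)).add
        (hδbs.hasDerivAt_px t x)).add ((hδbtt.hasDerivAt_px t x).const_mul (ε / 2))))
    refine Eq.trans ?_ (congrArg₂ (· + ·) hAt.deriv hBx.deriv).symm
    simp only [Pi.add_apply]
    linear_combination (-p t x) * hstate1 t ht x - q t x * hstate2 t ht x
      - δr t x * hadj1 t ht x - δV t x * hadj2 t ht x
end

section
/- Let T > 0, ε ∈ ℝ, and constants 0 < h_min ≤ h_max and M > 0. Let h̄, V̄, ζ, V, f, g : ℝ × ℝ → ℝ be smooth (C^∞) functions with ζ and V supported, in the space variable x, in a fixed compact subset of ℝ for every t ∈ [0,T]. Assume that on [0,T] × ℝ: (i) the symmetrized linear system ∂_t ζ + εV̄ ∂_x ζ + h̄ ∂_x V = f and h̄ ∂_t V + h̄ ∂_x ζ + ε h̄ V̄ ∂_x V = g holds; (ii) h_min ≤ h̄ ≤ h_max; (iii) |ε ∂_x V̄| ≤ M, |∂_t h̄| ≤ M, |ε ∂_x(h̄ V̄)| ≤ M,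 and |∂_x h̄| ≤ M. Then there exists a constant C > 0, depending only on M, h_min and h_max, such that for every t ∈ [0,T], ∫_ℝ (ζ(t,x)² + V(t,x)²) dx ≤ C e^{C t} ( ∫_ℝ (ζ(0,x)² + V(0,x)²) dx + ∫₀ᵗ ∫_ℝ (f(τ,x)² + g(τ,x)²) dx dτ ). -/
open MeasureTheory intervalIntegral

section PartialDerivatives

variable {F : ℝ → ℝ → ℝ}

lemma hasDerivAt_pt (hF : ContDiff ℝ (⊤ : ℕ∞) (fun z : ℝ × ℝ => F z.1 z.2)) (t x : ℝ) :
    HasDerivAt (fun s => F s x) (pt F t x) t := by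
  have h : ContDiff ℝ (⊤ : ℕ∞) (fun s => F s x) :=
    hF.comp (f := fun s : ℝ => (s, x)) (by fun_prop)
  exact (h.differentiable (by simp) t).hasDerivAt

lemma hasDerivAt_px (hF : ContDiff ℝ (⊤ : ℕ∞) (fun z : ℝ × ℝ => F z.1 z.2)) (t x : ℝ) :
    HasDerivAt (fun y => F t y) (px F t x) x := by
  have h : ContDiff ℝ (⊤ : ℕ∞) (fun y => F t y) :=
    hF.comp (f := fun y : ℝ => (t, y)) (by fun_prop)
  exact (h.differentiable (by simp) x).hasDerivAt

lemma fderiv_apply_one_zero (hF : ContDiff ℝ (⊤ : ℕ∞) (fun z : ℝ × ℝ => F z.1 z.2)) (t x : ℝ) :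
    fderiv ℝ (fun z : ℝ × ℝ => F z.1 z.2) (t, x) (1, 0) = pt F t x := by
  have h := (hF.differentiable (by simp) (t, x)).hasFDerivAt
  exact (h.comp_hasDerivAt (f := fun s : ℝ => (s, x)) t
    ((hasDerivAt_id t).prodMk (hasDerivAt_const t x))).unique (hasDerivAt_pt hF t x)

lemma fderiv_apply_zero_one (hF : ContDiff ℝ (⊤ : ℕ∞) (fun z : ℝ × ℝ => F z.1 z.2)) (t x : ℝ) :
    fderiv ℝ (fun z : ℝ × ℝ => F z.1 z.2) (t, x) (0, 1) = px F t x := by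
  have h := (hF.differentiable (by simp) (t, x)).hasFDerivAt
  exact (h.comp_hasDerivAt (f := fun y : ℝ => (t, y)) x
    ((hasDerivAt_const x t).prodMk (hasDerivAt_id x))).unique (hasDerivAt_px hF t x)

lemma pt_eq_zero_of_forall_Icc {T t x : ℝ} (hT : 0 < T)
    (hF : ContDiff ℝ (⊤ : ℕ∞) (fun z : ℝ × ℝ => F z.1 z.2))
    (h0 : ∀ s ∈ Set.Icc 0 T, F s x = 0) (ht : t ∈ Set.Icc 0 T) : pt F t x = 0 :=
  (uniqueDiffOn_Icc hT t ht).eq_deriv _ (hasDerivAt_pt hF t x).hasDerivWithinAt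
    ((hasDerivWithinAt_const t _ 0).congr h0 (h0 t ht))

lemma px_eq_zero_of_forall_notMem {K : Set ℝ} (hK : IsClosed K) {t x : ℝ}
    (h0 : ∀ y ∉ K, F t y = 0) (hx : x ∉ K) : px F t x = 0 := by
  have h : (fun y => F t y) =ᶠ[nhds x] fun _ => 0 := by
    filter_upwards [hK.isOpen_compl.mem_nhds hx] with y hy using h0 y hy
  rw [px, h.deriv_eq, deriv_const]

/-- Divergence theorem on `[0, t] × [a, b]` for a density `Φ` whose flux `Ψ` vanishes on the
lateral boundary, with an upper bound `G` on the divergence. -/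
lemma integral_le_of_pt_add_px_le {Φ Ψ G : ℝ → ℝ → ℝ}
    (hΦ : ContDiff ℝ (⊤ : ℕ∞) (fun z : ℝ × ℝ => Φ z.1 z.2))
    (hΨ : ContDiff ℝ (⊤ : ℕ∞) (fun z : ℝ × ℝ => Ψ z.1 z.2))
    (hG : Continuous (fun z : ℝ × ℝ => G z.1 z.2)) {t a b : ℝ} (ht : 0 ≤ t) (hab : a ≤ b)
    (ha : ∀ s ∈ Set.Icc 0 t, Ψ s a = 0) (hb : ∀ s ∈ Set.Icc 0 t, Ψ s b = 0)
    (hle : ∀ s ∈ Set.Icc 0 t, ∀ x, pt Φ s x + px Ψ s x ≤ G s x) :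
    ∫ x in a..b, Φ t x ≤ (∫ x in a..b, Φ 0 x) + ∫ s in (0:ℝ)..t, ∫ x in a..b, G s x := by
  have hcont : Continuous (fun z : ℝ × ℝ => pt Φ z.1 z.2 + px Ψ z.1 z.2) := by
    have h1 := (hΦ.continuous_fderiv (by simp)).clm_apply
      (continuous_const (y := ((1, 0) : ℝ × ℝ)))
    have h2 := (hΨ.continuous_fderiv (by simp)).clm_apply
      (continuous_const (y := ((0, 1) : ℝ × ℝ)))
    refine (h1.add h2).congr fun z => ?_
    rw [← fderiv_apply_one_zero hΦ, ← fderiv_apply_zero_one hΨ]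
    rfl
  have hdiv := integral2_divergence_prod_of_hasFDerivAt
    (fun z : ℝ × ℝ => Φ z.1 z.2) (fun z : ℝ × ℝ => Ψ z.1 z.2)
    (fderiv ℝ fun z : ℝ × ℝ => Φ z.1 z.2) (fderiv ℝ fun z : ℝ × ℝ => Ψ z.1 z.2) 0 a t b
    hΦ.continuous.continuousOn hΨ.continuous.continuousOn
    (fun z _ => (hΦ.differentiable (by simp) z).hasFDerivAt)
    (fun z _ => (hΨ.differentiable (by simp) z).hasFDerivAt)
    (by
      refine ContinuousOn.integrableOn_compact (isCompact_uIcc.prod isCompact_uIcc)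
        (hcont.congr fun z => ?_).continuousOn
      rw [← fderiv_apply_one_zero hΦ, ← fderiv_apply_zero_one hΨ])
  simp only [fderiv_apply_one_zero hΦ, fderiv_apply_zero_one hΨ] at hdiv
  have hzero : ∀ c, (∀ s ∈ Set.Icc 0 t, Ψ s c = 0) → ∫ s in (0:ℝ)..t, Ψ s c = 0 := by
    intro c hc
    refine (intervalIntegral.integral_congr fun s hs => ?_).trans intervalIntegral.integral_zero
    exact hc s (Set.uIcc_of_le ht ▸ hs)
  rw [hzero a ha, hzero b hb] at hdiv
  have hslice : ∀ {H : ℝ → ℝ → ℝ}, Continuous (fun z : ℝ × ℝ => H z.1 z.2) → ∀ s,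
      IntervalIntegrable (H s) volume a b := fun hH s =>
    (hH.comp (f := fun y : ℝ => (s, y)) (by fun_prop)).intervalIntegrable _ _
  have hmono : ∫ s in (0:ℝ)..t, ∫ x in a..b, (pt Φ s x + px Ψ s x)
      ≤ ∫ s in (0:ℝ)..t, ∫ x in a..b, G s x := by
    refine intervalIntegral.integral_mono_on ht ?_ ?_ fun s hs => ?_
    · exact (continuous_parametric_intervalIntegral_of_continuous' hcont a b).intervalIntegrable _ _
    · exact (continuous_parametric_intervalIntegral_of_continuous' hG a b).intervalIntegrable _ _
    · exact intervalIntegral.integral_mono_on hab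
        (hslice (H := fun s x => pt Φ s x + px Ψ s x) hcont s) (hslice hG s) fun x _ => hle s hs x
  linarith

end PartialDerivatives

/-- Pointwise bound for the source terms in the weighted energy balance; `α`, `β`, `γ`, `δ` stand
for `ε ∂ₓV̄`, `∂ₜh̄`, `ε ∂ₓ(h̄V̄)` and `∂ₓh̄`. -/
lemma energy_source_le {M m a h α β γ δ u v p q : ℝ}
    (hM : 0 < M) (hm : 0 < m) (hm1 : m ≤ 1) (hmh : m ≤ h) (ha : a * m = 1 + 3 * M)
    (hα : |α| ≤ M) (hβ : |β| ≤ M) (hγ : |γ| ≤ M) (hδ : |δ| ≤ M) :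
    -a * (u ^ 2 + h * v ^ 2) + 2 * u * p + 2 * v * q + β * v ^ 2 + α * u ^ 2
      + 2 * δ * u * v + γ * v ^ 2 ≤ p ^ 2 + q ^ 2 := by
  have ha0 : 0 ≤ a := by
    by_contra! hneg
    nlinarith
  have h1 : (1 + 3 * M) * u ^ 2 ≤ a * u ^ 2 := by
    rw [← ha]
    exact mul_le_mul_of_nonneg_right (by nlinarith) (sq_nonneg u)
  have h2 : (1 + 3 * M) * v ^ 2 ≤ a * h * v ^ 2 := by
    rw [← ha]
    exact mul_le_mul_of_nonneg_right (by nlinarith) (sq_nonneg v)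
  have h3 : α * u ^ 2 ≤ M * u ^ 2 :=
    mul_le_mul_of_nonneg_right (abs_le.1 hα).2 (sq_nonneg u)
  have h4 : β * v ^ 2 ≤ M * v ^ 2 :=
    mul_le_mul_of_nonneg_right (abs_le.1 hβ).2 (sq_nonneg v)
  have h5 : γ * v ^ 2 ≤ M * v ^ 2 :=
    mul_le_mul_of_nonneg_right (abs_le.1 hγ).2 (sq_nonneg v)
  have h6 : 2 * δ * u * v ≤ M * (u ^ 2 + v ^ 2) := by
    obtain ⟨hl, hr⟩ := abs_le.1 hδ
    nlinarith [mul_nonneg (sub_nonneg.2 hr) (sq_nonneg (u + v)),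
      mul_nonneg (by linarith : 0 ≤ M + δ) (sq_nonneg (u - v))]
  nlinarith [sq_nonneg (u - p), sq_nonneg (v - q), mul_nonneg hM.le (sq_nonneg u)]

/-- L² (s = 0, μ = 0) Grönwall-type energy estimate for the linearized, symmetrized
Boussinesq–Peregrine system: the constant `C` depends only on `M`, `h_min`, `h_max`. -/
theorem linearized_energy_estimate
    (h_min h_max M : ℝ) (hmin_pos : 0 < h_min) (hminmax : h_min ≤ h_max) (hM : 0 < M) :
    ∃ C > 0, ∀ (T ε : ℝ), 0 < T →
      ∀ (hbar Vbar ζ V f g : ℝ → ℝ → ℝ),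
      ContDiff ℝ (⊤ : ℕ∞) (fun z : ℝ × ℝ => hbar z.1 z.2) →
      ContDiff ℝ (⊤ : ℕ∞) (fun z : ℝ × ℝ => Vbar z.1 z.2) →
      ContDiff ℝ (⊤ : ℕ∞) (fun z : ℝ × ℝ => ζ z.1 z.2) →
      ContDiff ℝ (⊤ : ℕ∞) (fun z : ℝ × ℝ => V z.1 z.2) →
      ContDiff ℝ (⊤ : ℕ∞) (fun z : ℝ × ℝ => f z.1 z.2) →
      ContDiff ℝ (⊤ : ℕ∞) (fun z : ℝ × ℝ => g z.1 z.2) →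
      -- compact support in space, uniformly on [0,T]
      (∃ K : Set ℝ, IsCompact K ∧
        ∀ t ∈ Set.Icc (0:ℝ) T, ∀ x ∉ K, ζ t x = 0 ∧ V t x = 0) →
      -- (i) the symmetrized linear system
      (∀ t ∈ Set.Icc (0:ℝ) T, ∀ x : ℝ,
        pt ζ t x + ε * Vbar t x * px ζ t x + hbar t x * px V t x = f t x) →
      (∀ t ∈ Set.Icc (0:ℝ) T, ∀ x : ℝ,
        hbar t x * pt V t x + hbar t x * px ζ t x
          + ε * hbar t x * Vbar t x * px V t x = g t x) →
      -- (ii) depth bounds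
      (∀ t ∈ Set.Icc (0:ℝ) T, ∀ x : ℝ, h_min ≤ hbar t x ∧ hbar t x ≤ h_max) →
      -- (iii) coefficient bounds
      (∀ t ∈ Set.Icc (0:ℝ) T, ∀ x : ℝ,
        |ε * px Vbar t x| ≤ M ∧ |pt hbar t x| ≤ M ∧
        |ε * px (fun s y => hbar s y * Vbar s y) t x| ≤ M ∧ |px hbar t x| ≤ M) →
      ∀ t ∈ Set.Icc (0:ℝ) T,
        ∫ x : ℝ, ((ζ t x)^2 + (V t x)^2)
          ≤ C * Real.exp (C * t) *
              ((∫ x : ℝ, ((ζ 0 x)^2 + (V 0 x)^2))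
                + ∫ τ in (0:ℝ)..t, ∫ x : ℝ, ((f τ x)^2 + (g τ x)^2)) := by
  obtain ⟨m, hm_def⟩ : ∃ m, m = min 1 h_min := ⟨_, rfl⟩
  obtain ⟨N, hN_def⟩ : ∃ N, N = max 1 h_max := ⟨_, rfl⟩
  have hm : 0 < m := hm_def ▸ lt_min one_pos hmin_pos
  have hm1 : m ≤ 1 := hm_def ▸ min_le_left _ _
  have hmh : m ≤ h_min := hm_def ▸ min_le_right _ _
  have hN1 : 1 ≤ N := hN_def ▸ le_max_left _ _
  have hNh : h_max ≤ N := hN_def ▸ le_max_right _ _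
  obtain ⟨a, ha_def⟩ : ∃ a, a = (1 + 3 * M) / m := ⟨_, rfl⟩
  have ha0 : 0 < a := by rw [ha_def]; positivity
  have ham : a * m = 1 + 3 * M := by rw [ha_def]; field_simp
  have hN0 : 0 < N := by linarith
  refine ⟨N / m + a, by positivity, ?_⟩
  intro T ε hT hbar Vbar ζ V f g hhbar hVbar hζ hV hf hg ⟨K, hK, hsupp⟩ heq1 heq2 hdepth hcoef t ht
  have htT : ∀ s ∈ Set.Icc 0 t, s ∈ Set.Icc 0 T := fun s hs => ⟨hs.1, hs.2.trans ht.2⟩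
  have h0T : (0:ℝ) ∈ Set.Icc 0 T := ⟨le_rfl, hT.le⟩
  have hsource : ∀ s ∈ Set.Icc 0 T, ∀ x ∉ K, f s x = 0 ∧ g s x = 0 := by
    intro s hs x hx
    have e1 := pt_eq_zero_of_forall_Icc hT hζ (fun r hr => (hsupp r hr x hx).1) hs
    have e2 := pt_eq_zero_of_forall_Icc hT hV (fun r hr => (hsupp r hr x hx).2) hs
    have e3 := px_eq_zero_of_forall_notMem hK.isClosed (fun y hy => (hsupp s hs y hy).1) hx
    have e4 := px_eq_zero_of_forall_notMem hK.isClosed (fun y hy => (hsupp s hs y hy).2) hx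
    rw [← heq1 s hs x, ← heq2 s hs x, e1, e2, e3, e4]
    simp
  obtain ⟨R, hR0, hR⟩ : ∃ R > 0, K ⊆ Set.Ioo (-R) R := by
    obtain ⟨R, hR0, hR⟩ := hK.isBounded.subset_ball_lt 0 0
    exact ⟨R, hR0, by simpa [Real.ball_eq_Ioo] using hR⟩
  have hRn : -R ∉ K := fun h => lt_irrefl _ (hR h).1
  have hRp : R ∉ K := fun h => lt_irrefl _ (hR h).2
  have hline : ∀ φ : ℝ → ℝ, (∀ x ∉ K, φ x = 0) → ∫ x, φ x = ∫ x in (-R)..R, φ x := by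
    intro φ hφ
    refine (integral_eq_integral_of_support_subset fun x hx => ?_).symm
    exact Set.Ioo_subset_Ioc_self (hR (not_imp_comm.1 (hφ x) hx))
  have hstate : ∀ s ∈ Set.Icc 0 T, ∫ x, ((ζ s x) ^ 2 + (V s x) ^ 2)
      = ∫ x in (-R)..R, ((ζ s x) ^ 2 + (V s x) ^ 2) := fun s hs =>
    hline _ fun x hx => by simp [hsupp s hs x hx]
  have hforce : ∫ τ in (0:ℝ)..t, ∫ x, ((f τ x) ^ 2 + (g τ x) ^ 2)
      = ∫ τ in (0:ℝ)..t, ∫ x in (-R)..R, ((f τ x) ^ 2 + (g τ x) ^ 2) := by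
    refine intervalIntegral.integral_congr fun s hs => ?_
    rw [Set.uIcc_of_le ht.1] at hs
    exact hline _ fun x hx => by simp [hsource s (htT s hs) x hx]
  rw [hstate t ht, hstate 0 h0T, hforce]
  have hbalance := integral_le_of_pt_add_px_le
    (Φ := fun s x => Real.exp (-a * s) * ((ζ s x) ^ 2 + hbar s x * (V s x) ^ 2))
    (Ψ := fun s x => Real.exp (-a * s) * (ε * Vbar s x * (ζ s x) ^ 2
      + 2 * (hbar s x * (ζ s x * V s x)) + ε * (hbar s x * Vbar s x) * (V s x) ^ 2))
    (G := fun s x => (f s x) ^ 2 + (g s x) ^ 2)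
    (by fun_prop) (by fun_prop) (by fun_prop) ht.1 (by linarith : -R ≤ R)
    (fun s hs => by simp [hsupp s (htT s hs) _ hRn])
    (fun s hs => by simp [hsupp s (htT s hs) _ hRp])
    (by
      intro s hs x
      have hs' := htT s hs
      obtain ⟨c1, c2, c3, c4⟩ := hcoef s hs' x
      have hhV : ContDiff ℝ (⊤ : ℕ∞) (fun z : ℝ × ℝ => hbar z.1 z.2 * Vbar z.1 z.2) := by fun_prop
      have dexp : HasDerivAt (fun r => Real.exp (-a * r)) (Real.exp (-a * s) * (-a * 1)) s :=
        ((hasDerivAt_id s).const_mul (-a)).exp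
      have dΦ := (dexp.mul (((hasDerivAt_pt hζ s x).pow 2).add
        ((hasDerivAt_pt hhbar s x).mul ((hasDerivAt_pt hV s x).pow 2)))).deriv
      have dΨ := ((((((hasDerivAt_px hVbar s x).const_mul ε).mul
        ((hasDerivAt_px hζ s x).pow 2)).add (((hasDerivAt_px hhbar s x).mul
          ((hasDerivAt_px hζ s x).mul (hasDerivAt_px hV s x))).const_mul 2)).add
        (((hasDerivAt_px (F := fun s y => hbar s y * Vbar s y) hhV s x).const_mul ε).mul
          ((hasDerivAt_px hV s x).pow 2))).const_mul (Real.exp (-a * s))).deriv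
      have hsrc := energy_source_le (u := ζ s x) (v := V s x) (p := f s x) (q := g s x)
        hM hm hm1 (hmh.trans (hdepth s hs' x).1) ham c1 c2 c3 c4
      have hexp : Real.exp (-a * s) ≤ 1 := Real.exp_le_one_iff.2 (by nlinarith [hs.1])
      refine (le_of_eq ?_).trans ((mul_le_mul_of_nonneg_left hsrc (Real.exp_pos (-a * s)).le).trans
        (mul_le_of_le_one_left (by positivity) hexp))
      refine (congrArg₂ (· + ·) dΦ dΨ).trans ?_
      rw [← heq1 s hs' x, ← heq2 s hs' x]
      simp only [Pi.mul_apply, Pi.add_apply, Pi.pow_apply]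
      push_cast
      ring)
  have hslice : ∀ {H : ℝ → ℝ → ℝ}, ContDiff ℝ (⊤ : ℕ∞) (fun z : ℝ × ℝ => H z.1 z.2) → ∀ s,
      Continuous (H s) := fun hH s =>
    hH.continuous.comp (f := fun y : ℝ => (s, y)) (by fun_prop)
  have cζ := hslice hζ
  have cV := hslice hV
  have ch := hslice hhbar
  have hlow : m * ∫ x in (-R)..R, ((ζ t x) ^ 2 + (V t x) ^ 2)
      ≤ ∫ x in (-R)..R, ((ζ t x) ^ 2 + hbar t x * (V t x) ^ 2) := by
    rw [← intervalIntegral.integral_const_mul]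
    refine intervalIntegral.integral_mono_on (by linarith)
      (Continuous.intervalIntegrable (by fun_prop) _ _)
      (Continuous.intervalIntegrable (by fun_prop) _ _) fun x _ => ?_
    have := (hdepth t ht x).1
    nlinarith [mul_le_mul_of_nonneg_right hm1 (sq_nonneg (ζ t x)),
      mul_le_mul_of_nonneg_right (hmh.trans this) (sq_nonneg (V t x))]
  have hupp : ∫ x in (-R)..R, ((ζ 0 x) ^ 2 + hbar 0 x * (V 0 x) ^ 2)
      ≤ N * ∫ x in (-R)..R, ((ζ 0 x) ^ 2 + (V 0 x) ^ 2) := by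
    rw [← intervalIntegral.integral_const_mul]
    refine intervalIntegral.integral_mono_on (by linarith)
      (Continuous.intervalIntegrable (by fun_prop) _ _)
      (Continuous.intervalIntegrable (by fun_prop) _ _) fun x _ => ?_
    have := (hdepth 0 h0T x).2
    nlinarith [mul_le_mul_of_nonneg_right hN1 (sq_nonneg (ζ 0 x)),
      mul_le_mul_of_nonneg_right (this.trans hNh) (sq_nonneg (V 0 x))]
  have hI0 : 0 ≤ ∫ x in (-R)..R, ((ζ 0 x) ^ 2 + (V 0 x) ^ 2) :=
    intervalIntegral.integral_nonneg (by linarith) fun x _ => by positivity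
  have hF0 : 0 ≤ ∫ τ in (0:ℝ)..t, ∫ x in (-R)..R, ((f τ x) ^ 2 + (g τ x) ^ 2) :=
    intervalIntegral.integral_nonneg ht.1 fun τ _ =>
      intervalIntegral.integral_nonneg (by linarith) fun x _ => by positivity
  simp only [intervalIntegral.integral_const_mul, mul_zero, Real.exp_zero, one_mul] at hbalance
  generalize (∫ x in (-R)..R, ((ζ t x) ^ 2 + (V t x) ^ 2)) = It at *
  generalize (∫ x in (-R)..R, ((ζ 0 x) ^ 2 + (V 0 x) ^ 2)) = I₀ at *
  generalize (∫ τ in (0:ℝ)..t, ∫ x in (-R)..R, ((f τ x) ^ 2 + (g τ x) ^ 2)) = Q at *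
  have hdecay : Real.exp (-a * t) * (m * It) ≤ N * (I₀ + Q) := by
    have := mul_le_mul_of_nonneg_left hlow (Real.exp_pos (-a * t)).le
    nlinarith [mul_le_mul_of_nonneg_right hN1 hF0]
  have hgrow : It ≤ N / m * Real.exp (a * t) * (I₀ + Q) := by
    have h1 : Real.exp (a * t) * Real.exp (-a * t) = 1 := by
      rw [← Real.exp_add]; simp
    calc It = Real.exp (a * t) * Real.exp (-a * t) * It * (m / m) := by
          rw [h1, div_self hm.ne']; ring
      _ = Real.exp (a * t) / m * (Real.exp (-a * t) * (m * It)) := by ring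
      _ ≤ Real.exp (a * t) / m * (N * (I₀ + Q)) :=
          mul_le_mul_of_nonneg_left hdecay (by positivity)
      _ = N / m * Real.exp (a * t) * (I₀ + Q) := by ring
  refine hgrow.trans (mul_le_mul_of_nonneg_right ?_ (add_nonneg hI0 hF0))
  have hNm : 0 < N / m := by positivity
  exact mul_le_mul (by linarith)
    (Real.exp_le_exp.2 (mul_le_mul_of_nonneg_right (by linarith) ht.1))
    (Real.exp_pos _).le (by linarith)
end

section
/- Let μ ≥ 0, let 0 < h_min ≤ h_max, and let h : ℝ → ℝ be continuously differentiable with h_min ≤ h(x) ≤ h_max for all x ∈ ℝ. For a smooth compactly supported u : ℝ → ℝ, define (𝒯u)(x) = h(x)·u(x) − (μ/3)·d/dx( h(x)³·u′(x) ). Then h_min ∫_ℝ u(x)² dx + (μ/3) h_min³ ∫_ℝ u′(x)² dx ≤ ∫_ℝ (𝒯u)(x)·u(x) dx ≤ h_max ∫_ℝ u(x)² dx + (μ/3) h_max³ ∫_ℝ u′(x)² dx. -/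
open MeasureTheory

/-- The operator `𝒯` from the symmetrization of the Boussinesq–Peregrine system:
`(𝒯u)(x) = h(x)·u(x) − (μ/3)·d/dx( h(x)³·u′(x) )`. -/
noncomputable def Tcal (μ : ℝ) (h u : ℝ → ℝ) (x : ℝ) : ℝ :=
  h x * u x - μ / 3 * deriv (fun y => (h y)^3 * deriv u y) x

/-- A weight with values in `[a, b]` changes the integral of the square of a compactly supported
continuous function by a factor between `a` and `b`. -/
theorem integral_weight_mul_sq_bounds {a b : ℝ} {w f : ℝ → ℝ} (hw : Continuous w)
    (hf : Continuous f) (hf_supp : HasCompactSupport f) (hab : ∀ x, a ≤ w x ∧ w x ≤ b) :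
    a * (∫ x, f x ^ 2) ≤ ∫ x, w x * f x ^ 2 ∧ ∫ x, w x * f x ^ 2 ≤ b * ∫ x, f x ^ 2 := by
  have hsupp : HasCompactSupport fun x => f x ^ 2 :=
    hf_supp.comp_left (g := fun y => y ^ 2) (by simp)
  have hint : Integrable fun x => f x ^ 2 := (hf.pow 2).integrable_of_hasCompactSupport hsupp
  have hwint : Integrable fun x => w x * f x ^ 2 :=
    (hw.mul (hf.pow 2)).integrable_of_hasCompactSupport hsupp.mul_left
  rw [← integral_const_mul, ← integral_const_mul]
  exact ⟨integral_mono (hint.const_mul a) hwint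
      fun x => mul_le_mul_of_nonneg_right (hab x).1 (sq_nonneg _),
    integral_mono hwint (hint.const_mul b)
      fun x => mul_le_mul_of_nonneg_right (hab x).2 (sq_nonneg _)⟩

theorem integral_Tcal_mul_self (μ : ℝ) {h u : ℝ → ℝ} (hh : ContDiff ℝ 1 h)
    (hu : ContDiff ℝ 2 u) (hu_supp : HasCompactSupport u) :
    ∫ x, Tcal μ h u x * u x
      = (∫ x, h x * u x ^ 2) + μ / 3 * ∫ x, h x ^ 3 * deriv u x ^ 2 := by
  have hu' : ContDiff ℝ 1 (deriv u) := ContDiff.deriv' (by rwa [one_add_one_eq_two])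
  have hv : ContDiff ℝ 1 fun y => h y ^ 3 * deriv u y := (hh.pow 3).mul hu'
  have hv' : Continuous (deriv fun y => h y ^ 3 * deriv u y) := hv.continuous_deriv le_rfl
  have hsupp : HasCompactSupport fun x => u x ^ 2 :=
    hu_supp.comp_left (g := fun y => y ^ 2) (by simp)
  have hint : Integrable fun x => h x * u x ^ 2 :=
    (hh.continuous.mul (hu.continuous.pow 2)).integrable_of_hasCompactSupport hsupp.mul_left
  have huv' : Integrable fun x => u x * deriv (fun y => h y ^ 3 * deriv u y) x :=
    (hu.continuous.mul hv').integrable_of_hasCompactSupport hu_supp.mul_right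
  have hu'v : Integrable fun x => deriv u x * (h x ^ 3 * deriv u x) :=
    (hu'.continuous.mul hv.continuous).integrable_of_hasCompactSupport hu_supp.deriv.mul_right
  have huv : Integrable fun x => u x * (h x ^ 3 * deriv u x) :=
    (hu.continuous.mul hv.continuous).integrable_of_hasCompactSupport hu_supp.mul_right
  have hparts : ∫ x, u x * deriv (fun y => h y ^ 3 * deriv u y) x
      = -∫ x, h x ^ 3 * deriv u x ^ 2 := by
    have hsq : ∀ x, h x ^ 3 * deriv u x ^ 2 = deriv u x * (h x ^ 3 * deriv u x) :=
      fun x => by ring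
    simp_rw [hsq]
    exact integral_mul_deriv_eq_deriv_mul_of_integrable
      (fun x _ => (hu.differentiable two_ne_zero x).hasDerivAt)
      (fun x _ => (hv.differentiable one_ne_zero x).hasDerivAt)
      huv' hu'v huv
  calc ∫ x, Tcal μ h u x * u x
      = ∫ x, (h x * u x ^ 2 - μ / 3 * (u x * deriv (fun y => h y ^ 3 * deriv u y) x)) := by
        refine integral_congr_ae (.of_forall fun x => ?_)
        simp only [Tcal]
        ring
    _ = (∫ x, h x * u x ^ 2) + μ / 3 * ∫ x, h x ^ 3 * deriv u x ^ 2 := by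
        rw [integral_sub hint (huv'.const_mul _), integral_const_mul, hparts]
        ring

/-- Two-sided equivalence of the quadratic form `(𝒯u, u)_{L²}` with the μ-weighted
Sobolev quantity `∫ u² + (μ/3)∫ (u′)²`, with constants depending only on
`h_min` and `h_max`. -/
theorem Tcal_quadratic_form_bounds
    (μ h_min h_max : ℝ) (hμ : 0 ≤ μ) (hmin_pos : 0 < h_min) (hminmax : h_min ≤ h_max)
    (h : ℝ → ℝ) (hh : ContDiff ℝ 1 h)
    (hbound : ∀ x : ℝ, h_min ≤ h x ∧ h x ≤ h_max)
    (u : ℝ → ℝ) (hu : ContDiff ℝ (⊤ : ℕ∞) u) (hu_supp : HasCompactSupport u) :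
    h_min * (∫ x : ℝ, (u x)^2) + μ / 3 * h_min^3 * (∫ x : ℝ, (deriv u x)^2)
        ≤ ∫ x : ℝ, Tcal μ h u x * u x ∧
    ∫ x : ℝ, Tcal μ h u x * u x
        ≤ h_max * (∫ x : ℝ, (u x)^2) + μ / 3 * h_max^3 * (∫ x : ℝ, (deriv u x)^2) := by
  have hu2 : ContDiff ℝ 2 u := contDiff_infty.1 hu 2
  rw [integral_Tcal_mul_self μ hh hu2 hu_supp, mul_assoc, mul_assoc]
  obtain ⟨hl, hr⟩ := integral_weight_mul_sq_bounds hh.continuous hu.continuous hu_supp hbound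
  obtain ⟨hl', hr'⟩ := integral_weight_mul_sq_bounds (hh.continuous.pow 3)
    (hu2.continuous_deriv one_le_two) hu_supp.deriv fun x =>
      ⟨pow_le_pow_left₀ hmin_pos.le (hbound x).1 3,
        pow_le_pow_left₀ (hmin_pos.le.trans (hbound x).1) (hbound x).2 3⟩
  have hμ3 : 0 ≤ μ / 3 := by positivity
  exact ⟨add_le_add hl (mul_le_mul_of_nonneg_left hl' hμ3),
    add_le_add hr (mul_le_mul_of_nonneg_left hr' hμ3)⟩
end
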